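/- Let E be a finite-dimensional complex inner product space and let R be a Kähler curvature-type tensor on E with nonnegative holomorphic sectional curvature. Let e₁,…,e_m (m ≥ 2) be orthonormal vectors in E such that ∑_{j=1}^{m} R(v,v,e_j,e_j) ≤ 0 for every v ∈ E, and suppose there exists u ∈ E with R(u,u,e₁,e₁) > 0. Then there exists an index l with 2 ≤ l ≤ m such that R(e_l,e_l,e_l,e_l) > 0. -/

import Mathlib

open scoped ComplexConjugate InnerProductSpace

/-- A Kähler curvature-type tensor on a complex inner product space `E`:
a map `R : E × E × E × E → ℂ` which is ℂ-linear in the 1st and 3rd arguments,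
conjugate-ℂ-linear in the 2nd and 4th arguments, and satisfies the Kähler
symmetries `R(X,Y,Z,W) = R(Z,Y,X,W)`, `R(X,Y,Z,W) = R(X,W,Z,Y)` and
`R(X,Y,Z,W) = conj (R(Y,X,W,Z))`.  It models the curvature tensor of a
Kähler metric at a point, `R X Y Z W` corresponding to `R(X,Ȳ,Z,W̄)`. -/
structure KahlerCurvatureTensor (E : Type*) [NormedAddCommGroup E]
    [InnerProductSpace ℂ E] where
  R : E → E → E → E → ℂ
  add_fst : ∀ X X' Y Z W, R (X + X') Y Z W = R X Y Z W + R X' Y Z W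
  smul_fst : ∀ (a : ℂ) X Y Z W, R (a • X) Y Z W = a * R X Y Z W
  add_snd : ∀ X Y Y' Z W, R X (Y + Y') Z W = R X Y Z W + R X Y' Z W
  smul_snd : ∀ (a : ℂ) X Y Z W, R X (a • Y) Z W = conj a * R X Y Z W
  add_trd : ∀ X Y Z Z' W, R X Y (Z + Z') W = R X Y Z W + R X Y Z' W
  smul_trd : ∀ (a : ℂ) X Y Z W, R X Y (a • Z) W = a * R X Y Z W
  add_fth : ∀ X Y Z W W', R X Y Z (W + W') = R X Y Z W + R X Y Z W'
  smul_fth : ∀ (a : ℂ) X Y Z W, R X Y Z (a • W) = conj a * R X Y Z W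
  sym_fst_trd : ∀ X Y Z W, R X Y Z W = R Z Y X W
  sym_snd_fth : ∀ X Y Z W, R X Y Z W = R X W Z Y
  conj_sym : ∀ X Y Z W, R X Y Z W = conj (R Y X W Z)

namespace KahlerCurvatureTensor

variable {E : Type*} [NormedAddCommGroup E] [InnerProductSpace ℂ E]

theorem swap_pairs (R : KahlerCurvatureTensor E) (X Y Z W : E) :
    R.R X Y Z W = R.R Z W X Y := by
  rw [R.sym_fst_trd, R.sym_snd_fth]

/-- The average of the quartic form `V ↦ R(V,V,V,V)` over `x + c y`, with `c` ranging over the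
fourth roots of unity. -/
theorem sum_quartic_fourth_roots (R : KahlerCurvatureTensor E) (x y : E) :
    R.R (x + (1 : ℂ) • y) (x + (1 : ℂ) • y) (x + (1 : ℂ) • y) (x + (1 : ℂ) • y)
      + R.R (x + (-1 : ℂ) • y) (x + (-1 : ℂ) • y) (x + (-1 : ℂ) • y) (x + (-1 : ℂ) • y)
      + R.R (x + Complex.I • y) (x + Complex.I • y) (x + Complex.I • y) (x + Complex.I • y)
      + R.R (x + (-Complex.I) • y) (x + (-Complex.I) • y) (x + (-Complex.I) • y)
          (x + (-Complex.I) • y)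
      = 4 * R.R x x x x + 16 * R.R x x y y + 4 * R.R y y y y := by
  have expand (c : ℂ) : R.R (x + c • y) (x + c • y) (x + c • y) (x + c • y)
      = R.R x x x x + 2 * c * R.R y x x x + 2 * conj c * R.R x y x x
        + c ^ 2 * R.R y x y x + conj c ^ 2 * R.R x y x y + 4 * (c * conj c) * R.R x x y y
        + 2 * (c * conj c) * c * R.R y y y x + 2 * (c * conj c) * conj c * R.R y y x y
        + (c * conj c) ^ 2 * R.R y y y y := by
    simp only [R.add_fst, R.add_snd, R.add_trd, R.add_fth, R.smul_fst, R.smul_snd, R.smul_trd,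
      R.smul_fth]
    rw [R.sym_fst_trd x x y x, R.sym_snd_fth x x x y, R.swap_pairs y y x x,
      R.sym_snd_fth x y y x, R.sym_fst_trd y x x y, R.sym_snd_fth y x y y,
      R.sym_fst_trd x y y y]
    ring
  simp only [expand, map_neg, map_one, Complex.conj_I]
  linear_combination (2 * R.R y x y x + 2 * R.R x y x y - 8 * R.R x x y y
    + 2 * (Complex.I ^ 2 - 1) * R.R y y y y) * Complex.I_sq

theorem quartic_nonneg (R : KahlerCurvatureTensor E)
    (hH : ∀ V : E, V ≠ 0 → 0 ≤ (R.R V V V V).re / ‖V‖ ^ 4) (V : E) :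
    0 ≤ (R.R V V V V).re := by
  rcases eq_or_ne V 0 with rfl | hV
  · have h := R.smul_fst 0 0 0 0 0
    rw [zero_smul, zero_mul] at h
    simp [h]
  · have hpos : 0 < ‖V‖ ^ 4 := by positivity
    simpa [div_mul_cancel₀ _ hpos.ne'] using mul_nonneg (hH V hV) hpos.le

/-- If the quartic form is nonnegative and vanishes at `x`, then the bisectional curvatures
`R(x,x,v,v)` are nonnegative. -/
theorem bisectional_nonneg_of_quartic_eq_zero (R : KahlerCurvatureTensor E)
    (hR : ∀ V : E, 0 ≤ (R.R V V V V).re) {x : E} (hx : (R.R x x x x).re = 0) (v : E) :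
    0 ≤ (R.R x x v v).re := by
  have key (y : E) : 0 ≤ 4 * (R.R x x y y).re + (R.R y y y y).re := by
    have h := congrArg Complex.re (R.sum_quartic_fourth_roots x y)
    simp only [Complex.add_re, Complex.mul_re, Complex.re_ofNat, Complex.im_ofNat, zero_mul,
      sub_zero, hx] at h
    linarith [hR (x + (1 : ℂ) • y), hR (x + (-1 : ℂ) • y), hR (x + Complex.I • y),
      hR (x + (-Complex.I) • y)]
  have scaled (r : ℝ) (hr : 0 < r) : 0 ≤ 4 * (R.R x x v v).re + r ^ 2 * (R.R v v v v).re := by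
    have h := key ((r : ℂ) • v)
    simp only [R.smul_fst, R.smul_snd, R.smul_trd, R.smul_fth, Complex.conj_ofReal,
      Complex.re_ofReal_mul] at h
    refine nonneg_of_mul_nonneg_right (a := r ^ 2) ?_ (by positivity)
    linarith
  have lim : Filter.Tendsto (fun r : ℝ => 4 * (R.R x x v v).re + r ^ 2 * (R.R v v v v).re)
      (nhdsWithin 0 (Set.Ioi 0)) (nhds (4 * (R.R x x v v).re + 0 ^ 2 * (R.R v v v v).re)) :=
    (by fun_prop : Continuous fun r : ℝ =>
      4 * (R.R x x v v).re + r ^ 2 * (R.R v v v v).re).continuousWithinAt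
  have := ge_of_tendsto lim (Filter.eventually_of_mem self_mem_nhdsWithin scaled)
  linarith

end KahlerCurvatureTensor

/-- Claim in the proof of Theorem 1.6 (3): given orthonormal `e₁,…,e_m`
(`m ≥ 2`) with `∑ⱼ R(v,v̅,eⱼ,e̅ⱼ) ≤ 0` for all `v`, and some `u` with
`R(u,u̅,e₁,e̅₁) > 0`, there is `2 ≤ l ≤ m` with `R(e_l,e̅_l,e_l,e̅_l) > 0`. -/
theorem stmt_6 (E : Type*) [NormedAddCommGroup E] [InnerProductSpace ℂ E]
    [FiniteDimensional ℂ E] (R : KahlerCurvatureTensor E)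
    (hH : ∀ V : E, V ≠ 0 → 0 ≤ (R.R V V V V).re / ‖V‖ ^ 4)
    (m : ℕ) (hm : 2 ≤ m) (e : Fin m → E) (he : Orthonormal ℂ e)
    (hnonpos : ∀ v : E, ∑ j, (R.R v v (e j) (e j)).re ≤ 0)
    (u : E) (hu : 0 < (R.R u u (e ⟨0, by omega⟩) (e ⟨0, by omega⟩)).re) :
    ∃ l : Fin m, 1 ≤ (l : ℕ) ∧ 0 < (R.R (e l) (e l) (e l) (e l)).re := by
  by_contra! hneg
  have hR := R.quartic_nonneg hH
  have hrest (l : Fin m) (hl : l ≠ ⟨0, by omega⟩) : 0 ≤ (R.R u u (e l) (e l)).re := by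
    have hl' : 1 ≤ (l : ℕ) := Nat.one_le_iff_ne_zero.2 fun h => hl (Fin.ext h)
    rw [R.swap_pairs]
    exact R.bisectional_nonneg_of_quartic_eq_zero hR (le_antisymm (hneg l hl') (hR _)) u
  refine (hnonpos u).not_gt (Finset.sum_pos' (fun l _ => ?_) ⟨_, Finset.mem_univ _, hu⟩)
  by_cases hl : l = ⟨0, by omega⟩
  · exact hl ▸ hu.le
  · exact hrest l hl
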